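/- arXiv:1603.07195 — 6 statements merged into one kernel-verified Lean document; each statement's English description precedes it below -/
import Mathlib

section
/- Let E be a finite-dimensional real inner product space, h : E → ℝ a convex differentiable function whose gradient g = ∇h is Lipschitz continuous with constant L > 0, and suppose h attains its minimum at λ*. Let Γ, Δ, ε > 0 with 0 < ε < 2Γ/(L·Δ²), and let M(t) (t ∈ ℕ) be self-adjoint linear operators on E satisfying Γ·I ≼ M(t) ≼ Δ·I for all t. Define iterates by λ(t+1) = λ(t) − ε · M(t) (∇h(λ(t))), starting from any λ(0). If in addition there is R > 0 with ‖λ(t) − λ*‖ ≤ R for all t, then t · (h(λ(t)) − h(λ*)) → 0 as t → ∞; that is, h(λ(t)) − h(λ*) = o(1/t). -/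
open scoped RealInnerProductSpace

section Gradient

variable {E : Type*} [NormedAddCommGroup E] [InnerProductSpace ℝ E] [CompleteSpace E] {h : E → ℝ}

/-- The derivative of a differentiable function along a line. -/
lemma Differentiable.hasDerivAt_line (hdiff : Differentiable ℝ h) (x v : E) (s : ℝ) :
    HasDerivAt (fun r : ℝ => h (x + r • v)) ⟪gradient h (x + s • v), v⟫ s := by
  have hline : HasDerivAt (fun r : ℝ => x + r • v) v s := by
    simpa using ((hasDerivAt_id s).smul_const v).const_add x
  exact (hdiff (x + s • v)).hasGradientAt.hasFDerivAt.comp_hasDerivAt s hline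

/-- The first-order lower bound for a differentiable convex function. -/
lemma ConvexOn.add_inner_gradient_le (hconv : ConvexOn ℝ Set.univ h)
    (hdiff : Differentiable ℝ h) (x y : E) :
    h x + ⟪gradient h x, y - x⟫ ≤ h y := by
  have hline : ConvexOn ℝ Set.univ (fun r : ℝ => h (x + r • (y - x))) := by
    have hcomp := hconv.comp_affineMap (AffineMap.lineMap (k := ℝ) x y)
    refine hcomp.congr fun r _ => ?_
    simp [AffineMap.lineMap_apply, add_comm]
  have hslope := hline.le_slope_of_hasDerivAt (Set.mem_univ 0) (Set.mem_univ 1) one_pos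
    (hdiff.hasDerivAt_line x (y - x) 0)
  simp only [slope_def_field, zero_smul, one_smul, add_zero, add_sub_cancel, sub_zero,
    div_one] at hslope
  linarith

/-- The quadratic upper bound for a function with `L`-Lipschitz gradient. -/
lemma Differentiable.le_add_inner_gradient_add_sq (hdiff : Differentiable ℝ h) {L : ℝ}
    (hlip : ∀ x y : E, ‖gradient h x - gradient h y‖ ≤ L * ‖x - y‖) (x v : E) :
    h (x + v) ≤ h x + ⟪gradient h x, v⟫ + L / 2 * ‖v‖ ^ 2 := by
  have hderiv (s : ℝ) : HasDerivAt
      (fun r : ℝ => h (x + r • v) - (r * ⟪gradient h x, v⟫ + r ^ 2 * (L / 2 * ‖v‖ ^ 2)))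
      (⟪gradient h (x + s • v), v⟫ - (⟪gradient h x, v⟫ + 2 * s * (L / 2 * ‖v‖ ^ 2))) s := by
    refine (hdiff.hasDerivAt_line x v s).sub (HasDerivAt.add ?_ ?_)
    · simpa using (hasDerivAt_id s).mul_const ⟪gradient h x, v⟫
    · simpa using (hasDerivAt_pow 2 s).mul_const (L / 2 * ‖v‖ ^ 2)
  have hanti := antitoneOn_of_deriv_nonpos (convex_Ici (0 : ℝ))
    (fun s _ => (hderiv s).continuousAt.continuousWithinAt)
    (fun s _ => (hderiv s).differentiableAt.differentiableWithinAt) (fun s hs => by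
      have hs : 0 < s := by simpa using hs
      rw [(hderiv s).deriv]
      have hinner := real_inner_le_norm (gradient h (x + s • v) - gradient h x) v
      rw [inner_sub_left] at hinner
      have hnorm := hlip (x + s • v) x
      rw [add_sub_cancel_left, norm_smul, Real.norm_of_nonneg hs.le] at hnorm
      nlinarith [mul_le_mul_of_nonneg_right hnorm (norm_nonneg v)])
  have hle := hanti Set.self_mem_Ici (Set.mem_Ici.2 zero_le_one) zero_le_one
  simp only [one_smul, zero_smul, add_zero] at hle
  linarith

end Gradient

/-- A positive symmetric operator bounded above by `Δ` satisfies `M² ≼ Δ M`. -/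
lemma LinearMap.IsSymmetric.norm_apply_sq_le {E : Type*} [NormedAddCommGroup E]
    [InnerProductSpace ℝ E] {M : E →ₗ[ℝ] E} (hsym : M.IsSymmetric) {Δ : ℝ} (hΔ : 0 < Δ)
    (hpos : ∀ x : E, 0 ≤ ⟪x, M x⟫) (hub : ∀ x : E, ⟪x, M x⟫ ≤ Δ * ‖x‖ ^ 2) (x : E) :
    ‖M x‖ ^ 2 ≤ Δ * ⟪x, M x⟫ := by
  have hform := hpos (Δ • x - M x)
  have hMx := hub (M x)
  have hswap : ⟪x, M (M x)⟫ = ‖M x‖ ^ 2 := by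
    rw [← hsym x (M x), real_inner_self_eq_norm_sq]
  simp only [map_sub, map_smul, inner_sub_left, inner_sub_right, real_inner_smul_left,
    real_inner_smul_right, hswap, real_inner_self_eq_norm_sq] at hform
  have hscaled : 0 ≤ Δ * (Δ * ⟪x, M x⟫ - ‖M x‖ ^ 2) := by linarith
  linarith [nonneg_of_mul_nonneg_right hscaled hΔ]

/-- The `O(1 / n)` bound for a nonnegative sequence decreasing at a quadratic rate. -/
lemma mul_nat_mul_le_one_of_quadratic_decrease {a : ℕ → ℝ} (ha : ∀ n, 0 ≤ a n) {K : ℝ}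
    (hK : 0 < K) (hstep : ∀ n, a (n + 1) ≤ a n - K * a n ^ 2) (n : ℕ) :
    K * (n * a n) ≤ 1 := by
  induction n with
  | zero => simp
  | succ n ih =>
    have hu : 0 ≤ K * a n := mul_nonneg hK.le (ha n)
    have hu' : K * a (n + 1) ≤ K * a n * (1 - K * a n) := by
      nlinarith [mul_le_mul_of_nonneg_left (hstep n) hK.le]
    have hnext : 0 ≤ K * a (n + 1) := mul_nonneg hK.le (ha _)
    have hle : K * a n ≤ 1 := by nlinarith
    have hn : (0 : ℝ) ≤ n + 1 := by positivity
    push_cast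
    nlinarith [mul_le_mul_of_nonneg_left hu' hn,
      mul_le_mul_of_nonneg_right ih (sub_nonneg.2 hle)]

/-- A nonnegative sequence decreasing eventually at every quadratic rate is `o(1 / t)`. -/
lemma tendsto_nat_mul_zero_of_eventually_quadratic_decrease {a : ℕ → ℝ} (ha : ∀ n, 0 ≤ a n)
    (hlim : Filter.Tendsto a Filter.atTop (nhds 0))
    (hstep : ∀ K > 0, ∀ᶠ n in Filter.atTop, a (n + 1) ≤ a n - K * a n ^ 2) :
    Filter.Tendsto (fun n : ℕ => (n : ℝ) * a n) Filter.atTop (nhds 0) := by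
  rw [Metric.tendsto_atTop]
  intro δ hδ
  obtain ⟨T, hT⟩ := Filter.eventually_atTop.1 (hstep (2 / δ) (by positivity))
  have hsmall : ∀ᶠ n in Filter.atTop, T * a n < δ / 2 := by
    have := hlim.const_mul (T : ℝ)
    rw [mul_zero] at this
    exact this.eventually (gt_mem_nhds (by positivity))
  obtain ⟨N, hN⟩ := Filter.eventually_atTop.1 hsmall
  refine ⟨max T N, fun n hn => ?_⟩
  obtain ⟨m, rfl⟩ := Nat.exists_eq_add_of_le (le_of_max_le_left hn)
  have hrate := mul_nat_mul_le_one_of_quadratic_decrease (a := fun m => a (T + m))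
    (fun m => ha _) (by positivity : 0 < 2 / δ) (fun m => hT (T + m) (by omega)) m
  have hbound : m * a (T + m) ≤ δ / 2 := by
    rw [div_mul_eq_mul_div, div_le_one hδ] at hrate
    linarith
  rw [Real.dist_0_eq_abs, abs_of_nonneg (mul_nonneg (Nat.cast_nonneg _) (ha _))]
  push_cast
  linarith [hN _ (le_of_max_le_right hn)]

/-- A bounded minimizing sequence in a proper space approaches the set of minimizers. -/
lemma eventually_exists_minimizer_dist_lt {X : Type*} [PseudoMetricSpace X] [ProperSpace X]
    {f : X → ℝ} (hf : Continuous f) {m : ℝ} {u : ℕ → X} (hu : Bornology.IsBounded (Set.range u))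
    (hlim : Filter.Tendsto (fun n => f (u n)) Filter.atTop (nhds m)) {η : ℝ} (hη : 0 < η) :
    ∀ᶠ n in Filter.atTop, ∃ x, f x = m ∧ dist (u n) x < η := by
  by_contra hfreq
  obtain ⟨φ, hφ, hfar⟩ :=
    Filter.extraction_of_frequently_atTop (Filter.not_eventually.1 hfreq)
  obtain ⟨x, -, ψ, hψ, hx⟩ := tendsto_subseq_of_bounded hu (fun n => Set.mem_range_self (φ n))
  have hfx : f x = m := tendsto_nhds_unique ((hf.tendsto x).comp hx)
    (hlim.comp (hφ.tendsto_atTop.comp hψ.tendsto_atTop))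
  obtain ⟨n, hn⟩ := (hx.eventually (Metric.ball_mem_nhds x hη)).exists
  exact hfar (ψ n) ⟨x, hfx, hn⟩

/-- Theorem 1: preconditioned gradient descent with self-adjoint preconditioners whose
eigenvalues lie in `[Γ, Δ]`, on a convex function with `L`-Lipschitz gradient attaining
its minimum, with step size `ε < 2Γ/(L Δ²)` and bounded iterates, has objective error
`h(λ(t)) - h(λ*) = o(1/t)`. -/
theorem stmt1
    {E : Type*} [NormedAddCommGroup E] [InnerProductSpace ℝ E] [FiniteDimensional ℝ E]
    (h : E → ℝ) (hconv : ConvexOn ℝ Set.univ h) (hdiff : Differentiable ℝ h)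
    (L : ℝ) (hL : 0 < L)
    (hlip : ∀ x y : E, ‖gradient h x - gradient h y‖ ≤ L * ‖x - y‖)
    (lstar : E) (hmin : ∀ y : E, h lstar ≤ h y)
    (Γ Δ ε : ℝ) (hΓ : 0 < Γ) (hΔ : 0 < Δ) (hε : 0 < ε) (hεlt : ε < 2 * Γ / (L * Δ ^ 2))
    (M : ℕ → E →ₗ[ℝ] E) (hsym : ∀ t, (M t).IsSymmetric)
    (hlb : ∀ t (x : E), Γ * ‖x‖ ^ 2 ≤ ⟪x, M t x⟫)
    (hub : ∀ t (x : E), ⟪x, M t x⟫ ≤ Δ * ‖x‖ ^ 2)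
    (lam : ℕ → E)
    (hiter : ∀ t, lam (t + 1) = lam t - ε • M t (gradient h (lam t)))
    (R : ℝ) (hR : 0 < R) (hbdd : ∀ t, ‖lam t - lstar‖ ≤ R) :
    Filter.Tendsto (fun t : ℕ => (t : ℝ) * (h (lam t) - h lstar)) Filter.atTop (nhds 0) := by
  have hcomplete : CompleteSpace E := FiniteDimensional.complete ℝ E
  have hproper : ProperSpace E := FiniteDimensional.proper ℝ E
  set a : ℕ → ℝ := fun t => h (lam t) - h lstar with ha_def
  have ha (t : ℕ) : 0 ≤ a t := sub_nonneg.2 (hmin _)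
  obtain ⟨c, hc, hdescent⟩ : ∃ c > 0, ∀ t, a (t + 1) ≤ a t - c * ‖gradient h (lam t)‖ ^ 2 := by
    rw [lt_div_iff₀ (by positivity)] at hεlt
    refine ⟨ε * (Γ - L * ε * Δ ^ 2 / 2), mul_pos hε (by linarith), fun t => ?_⟩
    have hquad := hdiff.le_add_inner_gradient_add_sq hlip (lam t)
      (-(ε • M t (gradient h (lam t))))
    rw [← sub_eq_add_neg, ← hiter, inner_neg_right, real_inner_smul_right, norm_neg, norm_smul,
      Real.norm_of_nonneg hε.le] at hquad
    have hnorm := (hsym t).norm_apply_sq_le hΔ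
      (fun x => le_trans (by positivity) (hlb t x)) (hub t) (gradient h (lam t))
    have hnorm' : ‖M t (gradient h (lam t))‖ ^ 2 ≤ Δ * (Δ * ‖gradient h (lam t)‖ ^ 2) :=
      hnorm.trans (mul_le_mul_of_nonneg_left (hub t _) hΔ.le)
    have hlower := mul_le_mul_of_nonneg_left (hlb t (gradient h (lam t))) hε.le
    have hupper := mul_le_mul_of_nonneg_left hnorm' (by positivity : 0 ≤ L / 2 * ε ^ 2)
    simp only [ha_def]
    linarith
  have hrate {t : ℕ} {x : E} {r : ℝ} (hr : 0 < r) (hx : h x = h lstar) (hdist : ‖lam t - x‖ ≤ r) :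
      a (t + 1) ≤ a t - c / r ^ 2 * a t ^ 2 := by
    have hgrad := hconv.add_inner_gradient_le hdiff (lam t) x
    have hcs := real_inner_le_norm (gradient h (lam t)) (lam t - x)
    rw [← neg_sub, inner_neg_right] at hgrad
    have hle : a t ≤ ‖gradient h (lam t)‖ * r := by
      have := mul_le_mul_of_nonneg_left hdist (norm_nonneg (gradient h (lam t)))
      simp only [ha_def]
      linarith
    have hsq : c / r ^ 2 * a t ^ 2 ≤ c * ‖gradient h (lam t)‖ ^ 2 := calc
      c / r ^ 2 * a t ^ 2 ≤ c / r ^ 2 * (‖gradient h (lam t)‖ * r) ^ 2 := by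
        gcongr
        exact ha t
      _ = c * ‖gradient h (lam t)‖ ^ 2 := by field_simp
    linarith [hdescent t]
  have hlim : Filter.Tendsto a Filter.atTop (nhds 0) := by
    have hK : 0 < c / R ^ 2 := by positivity
    have hbound := mul_nat_mul_le_one_of_quadratic_decrease ha hK
      (fun t => hrate hR rfl (hbdd t))
    refine tendsto_of_tendsto_of_tendsto_of_le_of_le' tendsto_const_nhds
      (tendsto_const_div_atTop_nhds_zero_nat (c / R ^ 2)⁻¹) (.of_forall ha) ?_
    filter_upwards [Filter.eventually_gt_atTop 0] with t ht
    rw [le_div_iff₀ (by exact_mod_cast ht), ← one_div, le_div_iff₀ hK]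
    linarith [hbound t]
  refine tendsto_nat_mul_zero_of_eventually_quadratic_decrease ha hlim fun K hK => ?_
  have hbounded : Bornology.IsBounded (Set.range lam) :=
    (Metric.isBounded_closedBall (x := lstar) (r := R)).subset <| by
      rintro _ ⟨t, rfl⟩
      simpa [dist_eq_norm] using hbdd t
  have hvalues : Filter.Tendsto (fun t => h (lam t)) Filter.atTop (nhds (h lstar)) := by
    simpa [ha_def] using hlim.add_const (h lstar)
  filter_upwards [eventually_exists_minimizer_dist_lt hdiff.continuous hbounded hvalues
    (Real.sqrt_pos.2 (div_pos hc hK))] with t ⟨x, hx, hdist⟩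
  have hstep := hrate (Real.sqrt_pos.2 (div_pos hc hK)) hx (dist_eq_norm (lam t) x ▸ hdist.le)
  rwa [Real.sq_sqrt (div_pos hc hK).le, div_div_cancel₀ hc.ne'] at hstep
end

section
/- Let E, F be finite-dimensional real inner product spaces, A : E → F a continuous linear map, μ > 0, and f : E → ℝ a function such that −f is μ-strongly convex on E. For λ ∈ F define the Lagrangian L(x, λ) = f(x) + ⟪λ, A x⟫, let x(λ) ∈ E be a maximizer over E of x ↦ L(x, λ), and define the dual function h(λ) := L(x(λ), λ). Suppose x* ∈ E satisfies A x* = 0, and λ* ∈ F satisfies h(λ*) = f(x*) and h(λ*) ≤ h(λ) for all λ. Then for every λ ∈ F, (μ/2)·‖x(λ) − x*‖² ≤ h(λ) − h(λ*). -/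
open scoped RealInnerProductSpace

/-- A strongly convex function grows at least quadratically away from a minimizer. -/
lemma StrongConvexOn.half_mul_sq_norm_sub_le_of_isMinOn
    {E : Type*} [NormedAddCommGroup E] [NormedSpace ℝ E] {s : Set E} {m : ℝ} {g : E → ℝ}
    (hg : StrongConvexOn s m g) {a y : E} (ha : a ∈ s) (hmin : IsMinOn g s a) (hy : y ∈ s) :
    m / 2 * ‖a - y‖ ^ 2 ≤ g y - g a := by
  have hle : ∀ t ∈ Set.Ioo (0 : ℝ) 1, (1 - t) * (m / 2 * ‖a - y‖ ^ 2) ≤ g y - g a := by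
    rintro t ⟨ht0, ht1⟩
    have hsub : 0 ≤ 1 - t := by linarith
    have hconv := hg.2 ha hy hsub ht0.le (by ring)
    have hval := isMinOn_iff.1 hmin _ (hg.1 ha hy hsub ht0.le (by ring))
    simp only [smul_eq_mul] at hconv
    refine le_of_mul_le_mul_left ?_ ht0
    linarith
  have hlim : Filter.Tendsto (fun t : ℝ => (1 - t) * (m / 2 * ‖a - y‖ ^ 2))
      (nhdsWithin 0 (Set.Ioi 0)) (nhds (m / 2 * ‖a - y‖ ^ 2)) := by
    have hcont : Continuous fun t : ℝ => (1 - t) * (m / 2 * ‖a - y‖ ^ 2) := by fun_prop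
    simpa using (hcont.tendsto 0).mono_left nhdsWithin_le_nhds
  refine le_of_tendsto hlim ?_
  filter_upwards [Ioo_mem_nhdsGT (zero_lt_one' ℝ)] with t ht using hle t ht

/-- Key inequality in Corollary 1: `(μ/2)‖x(λ) - x*‖² ≤ h(λ) - h(λ*)` for a μ-strongly
concave primal objective, feasible primal optimum `x*` (`A x* = 0`), and zero duality gap. -/
theorem stmt2
    {E F : Type*} [NormedAddCommGroup E] [InnerProductSpace ℝ E] [FiniteDimensional ℝ E]
    [NormedAddCommGroup F] [InnerProductSpace ℝ F] [FiniteDimensional ℝ F]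
    (A : E →L[ℝ] F) (μ : ℝ) (hμ : 0 < μ)
    (f : E → ℝ) (hf : StrongConvexOn Set.univ μ (-f))
    (x : F → E)
    (hmax : ∀ (lam : F) (y : E), f y + ⟪lam, A y⟫ ≤ f (x lam) + ⟪lam, A (x lam)⟫)
    (h : F → ℝ) (hdef : ∀ lam : F, h lam = f (x lam) + ⟪lam, A (x lam)⟫)
    (xstar : E) (hfeas : A xstar = 0)
    (lstar : F) (hgap : h lstar = f xstar) (hdualmin : ∀ lam : F, h lstar ≤ h lam) :
    ∀ lam : F, μ / 2 * ‖x lam - xstar‖ ^ 2 ≤ h lam - h lstar := by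
  intro lam
  have hlin : ConvexOn ℝ Set.univ fun y => -⟪lam, A y⟫ :=
    (-((innerSL ℝ lam).comp A)).toLinearMap.convexOn convex_univ
  have hneg : StrongConvexOn Set.univ μ (-f + fun y => -⟪lam, A y⟫) := by
    simpa [StrongConvexOn] using UniformConvexOn.add hf (uniformConvexOn_zero.2 hlin)
  have hmin : IsMinOn (-f + fun y => -⟪lam, A y⟫) Set.univ (x lam) := by
    refine isMinOn_iff.2 fun y _ => ?_
    simp only [Pi.add_apply, Pi.neg_apply]
    linarith [hmax lam y]
  have hgrowth := hneg.half_mul_sq_norm_sub_le_of_isMinOn (Set.mem_univ _) hmin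
    (Set.mem_univ xstar)
  simp only [Pi.add_apply, Pi.neg_apply, hfeas, inner_zero_right] at hgrowth
  linarith [hdef lam]
end

section
/- Let N, n be positive naturals and v, r ∈ ℝ^N. For each i = 1, …, n, let Mᵢ be a positive natural, Sᵢ an N × Mᵢ real matrix, Dᵢ an Mᵢ × Mᵢ real matrix, and Bᵢ an invertible Mᵢ × Mᵢ real matrix. Assume that for each i the local secant condition Bᵢ (Dᵢ Sᵢᵀ v) = Sᵢᵀ r holds, and that Σᵢ Sᵢ Dᵢ Sᵢᵀ = I_N. Then the matrix H := Σᵢ Sᵢ Bᵢ⁻¹ Sᵢᵀ satisfies the global secant condition H r = v. -/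
open Matrix

/-- Remark 1: if each local curvature matrix `Bᵢ` satisfies the local secant condition
`Bᵢ (Dᵢ Sᵢᵀ v) = Sᵢᵀ r` and the normalizations satisfy `∑ᵢ Sᵢ Dᵢ Sᵢᵀ = I`, then the
global Hessian inverse approximation `H = ∑ᵢ Sᵢ Bᵢ⁻¹ Sᵢᵀ` satisfies the global secant
condition `H r = v`. -/
theorem stmt8 (N n : ℕ) (hN : 0 < N) (hn : 0 < n) (v r : Fin N → ℝ)
    (M : Fin n → ℕ) (hM : ∀ i, 0 < M i)
    (S : ∀ i : Fin n, Matrix (Fin N) (Fin (M i)) ℝ)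
    (D : ∀ i : Fin n, Matrix (Fin (M i)) (Fin (M i)) ℝ)
    (B : ∀ i : Fin n, Matrix (Fin (M i)) (Fin (M i)) ℝ)
    (hBinv : ∀ i, IsUnit (B i))
    (hsecant : ∀ i, B i *ᵥ (D i *ᵥ ((S i)ᵀ *ᵥ v)) = (S i)ᵀ *ᵥ r)
    (hpart : ∑ i, S i * D i * (S i)ᵀ = (1 : Matrix (Fin N) (Fin N) ℝ)) :
    (∑ i, S i * (B i)⁻¹ * (S i)ᵀ) *ᵥ r = v := by
  have hlocal : ∀ i, (S i * (B i)⁻¹ * (S i)ᵀ) *ᵥ r = (S i * D i * (S i)ᵀ) *ᵥ v := by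
    intro i
    have hdet : IsUnit (B i).det := (Matrix.isUnit_iff_isUnit_det _).mp (hBinv i)
    rw [← mulVec_mulVec, ← hsecant i, mulVec_mulVec, Matrix.mul_assoc,
      nonsing_inv_mul _ hdet, Matrix.mul_one, mulVec_mulVec, mulVec_mulVec, Matrix.mul_assoc]
  rw [sum_mulVec, Finset.sum_congr rfl fun i _ => hlocal i, ← sum_mulVec, hpart, one_mulVec]
end

section
/- Let E, F be finite-dimensional real inner product spaces, A : E → F a continuous linear map, μ > 0, and f : E → ℝ a function such that −f is μ-strongly convex on E. For λ ∈ F, let x(λ) ∈ E be a maximizer over E of x ↦ f(x) + ⟪λ, A x⟫. Then for all λ, λ' ∈ F, μ·‖x(λ) − x(λ')‖² ≤ ⟪λ − λ', A(x(λ)) − A(x(λ'))⟫; consequently ‖x(λ) − x(λ')‖ ≤ (1/μ)·‖A*(λ − λ')‖, where A* is the adjoint of A. -/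
open scoped RealInnerProductSpace

/-- A uniformly convex function grows at least like its modulus away from a minimizer. -/
lemma UniformConvexOn.le_sub_of_isMinOn {E : Type*} [NormedAddCommGroup E] [NormedSpace ℝ E]
    {s : Set E} {φ : ℝ → ℝ} {g : E → ℝ} {x y : E} (hg : UniformConvexOn s φ g)
    (hmin : IsMinOn g s x) (hx : x ∈ s) (hy : y ∈ s) : φ ‖x - y‖ ≤ g y - g x := by
  have hlim : Filter.Tendsto (fun t : ℝ ↦ (1 - t) * φ ‖x - y‖) (nhdsWithin 0 (Set.Ioi 0))
      (nhds (φ ‖x - y‖)) := by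
    have hcont : Continuous fun t : ℝ ↦ (1 - t) * φ ‖x - y‖ := by fun_prop
    simpa using (hcont.tendsto 0).mono_left nhdsWithin_le_nhds
  refine le_of_tendsto hlim ?_
  filter_upwards [Ioo_mem_nhdsGT (zero_lt_one (α := ℝ))] with t ⟨ht0, ht1⟩
  have hconv := hg.2 hx hy (sub_nonneg.2 ht1.le) ht0.le (sub_add_cancel 1 t)
  have hle := isMinOn_iff.1 hmin _
    (hg.1 hx hy (sub_nonneg.2 ht1.le) ht0.le (sub_add_cancel 1 t))
  simp only [smul_eq_mul] at hconv
  refine le_of_mul_le_mul_left ?_ ht0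
  linarith

/-- Quadratic decay of a strongly concave function plus a linear one away from a maximizer. -/
lemma StrongConvexOn.sq_norm_sub_le_of_forall_le {E : Type*} [NormedAddCommGroup E]
    [NormedSpace ℝ E] {μ : ℝ} {f : E → ℝ} (hf : StrongConvexOn Set.univ μ (-f))
    (l : E →ₗ[ℝ] ℝ) {x : E} (hmax : ∀ y, f y + l y ≤ f x + l x) (y : E) :
    μ / 2 * ‖x - y‖ ^ 2 ≤ f x + l x - (f y + l y) := by
  have hl : UniformConvexOn Set.univ 0 (-l : E → ℝ) :=
    ((-l).convexOn convex_univ).uniformConvexOn_zero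
  have hmin : IsMinOn (-f + -l : E → ℝ) Set.univ x := by
    refine isMinOn_iff.2 fun z _ ↦ ?_
    simp only [Pi.add_apply, Pi.neg_apply]
    linarith [hmax z]
  have h := (UniformConvexOn.add hf hl).le_sub_of_isMinOn hmin (Set.mem_univ x) (Set.mem_univ y)
  simp only [Pi.add_apply, Pi.neg_apply, Pi.zero_apply] at h
  linarith

/-- Lipschitz property of the Lagrangian maximizer map: for a μ-strongly concave primal
objective, `μ ‖x(λ) - x(λ')‖² ≤ ⟪λ - λ', A x(λ) - A x(λ')⟫` and hence
`‖x(λ) - x(λ')‖ ≤ (1/μ) ‖A*(λ - λ')‖`. -/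
theorem stmt14
    {E F : Type*} [NormedAddCommGroup E] [InnerProductSpace ℝ E] [FiniteDimensional ℝ E]
    [NormedAddCommGroup F] [InnerProductSpace ℝ F] [FiniteDimensional ℝ F]
    (A : E →L[ℝ] F) (μ : ℝ) (hμ : 0 < μ)
    (f : E → ℝ) (hf : StrongConvexOn Set.univ μ (-f))
    (x : F → E)
    (hmax : ∀ (lam : F) (y : E), f y + ⟪lam, A y⟫ ≤ f (x lam) + ⟪lam, A (x lam)⟫) :
    ∀ lam lam' : F,
      μ * ‖x lam - x lam'‖ ^ 2 ≤ ⟪lam - lam', A (x lam) - A (x lam')⟫ ∧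
      ‖x lam - x lam'‖ ≤ (1 / μ) * ‖ContinuousLinearMap.adjoint A (lam - lam')‖ := by
  intro lam lam'
  have hmono : μ * ‖x lam - x lam'‖ ^ 2 ≤ ⟪lam - lam', A (x lam) - A (x lam')⟫ := by
    have h := hf.sq_norm_sub_le_of_forall_le ((innerSL ℝ lam ∘L A : E →L[ℝ] ℝ) : E →ₗ[ℝ] ℝ)
      (hmax lam) (x lam')
    have h' := hf.sq_norm_sub_le_of_forall_le ((innerSL ℝ lam' ∘L A : E →L[ℝ] ℝ) : E →ₗ[ℝ] ℝ)
      (hmax lam') (x lam)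
    rw [norm_sub_rev] at h'
    simp only [ContinuousLinearMap.coe_coe, ContinuousLinearMap.comp_apply,
      innerSL_apply_apply] at h h'
    simp only [inner_sub_left, inner_sub_right]
    linarith
  refine ⟨hmono, ?_⟩
  rw [← map_sub, ← ContinuousLinearMap.adjoint_inner_left] at hmono
  have hcs := hmono.trans (real_inner_le_norm _ _)
  rw [one_div, ← div_eq_inv_mul, le_div_iff₀ hμ]
  rcases (norm_nonneg (x lam - x lam')).eq_or_lt with h0 | hpos
  · simp [← h0]
  · refine le_of_mul_le_mul_right ?_ hpos
    linarith
end

section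
/- Let E, F be finite-dimensional real inner product spaces, A : E → F a continuous linear map with operator norm ‖A‖, μ > 0, and f : E → ℝ a function such that −f is μ-strongly convex on E. For λ ∈ F, let x(λ) ∈ E be a maximizer over E of x ↦ f(x) + ⟪λ, A x⟫. Then the map λ ↦ A(x(λ)) is Lipschitz continuous with constant ‖A‖²/μ: for all λ, λ' ∈ F, ‖A(x(λ)) − A(x(λ'))‖ ≤ (‖A‖²/μ)·‖λ − λ'‖. -/
open scoped RealInnerProductSpace

/-- A strongly convex function grows at least quadratically away from a minimizer. -/
theorem StrongConvexOn.add_sq_norm_sub_le_of_isMinOn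
    {E : Type*} [NormedAddCommGroup E] [NormedSpace ℝ E] {s : Set E} {m : ℝ} {g : E → ℝ}
    (hg : StrongConvexOn s m g) {x y : E} (hx : x ∈ s) (hy : y ∈ s) (hmin : IsMinOn g s x) :
    g x + m / 2 * ‖x - y‖ ^ 2 ≤ g y := by
  have key : ∀ t ∈ Set.Ioo (0 : ℝ) 1, t * (m / 2 * ‖x - y‖ ^ 2) ≤ g y - g x := by
    rintro t ⟨ht0, ht1⟩
    have hconv := hg.2 hx hy ht0.le (sub_nonneg.2 ht1.le) (add_sub_cancel t 1)
    have hle := isMinOn_iff.1 hmin _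
      (hg.1 hx hy ht0.le (sub_nonneg.2 ht1.le) (add_sub_cancel t 1))
    simp only [smul_eq_mul] at hconv
    refine le_of_mul_le_mul_left ?_ (sub_pos.2 ht1)
    linarith
  have hlim : Filter.Tendsto (fun t : ℝ ↦ t * (m / 2 * ‖x - y‖ ^ 2))
      (nhdsWithin 1 (Set.Iio 1)) (nhds (1 * (m / 2 * ‖x - y‖ ^ 2))) :=
    ((continuous_id.mul continuous_const).tendsto 1).mono_left nhdsWithin_le_nhds
  have := le_of_tendsto hlim (Filter.mem_of_superset (Ioo_mem_nhdsLT one_pos) key)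
  linarith

/-- Inequality (17) in abstract form: the dual gradient map `λ ↦ A x(λ)` is Lipschitz
continuous with constant `‖A‖²/μ`. -/
theorem stmt15
    {E F : Type*} [NormedAddCommGroup E] [InnerProductSpace ℝ E] [FiniteDimensional ℝ E]
    [NormedAddCommGroup F] [InnerProductSpace ℝ F] [FiniteDimensional ℝ F]
    (A : E →L[ℝ] F) (μ : ℝ) (hμ : 0 < μ)
    (f : E → ℝ) (hf : StrongConvexOn Set.univ μ (-f))
    (x : F → E)
    (hmax : ∀ (lam : F) (y : E), f y + ⟪lam, A y⟫ ≤ f (x lam) + ⟪lam, A (x lam)⟫) :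
    ∀ lam lam' : F,
      ‖A (x lam) - A (x lam')‖ ≤ ‖A‖ ^ 2 / μ * ‖lam - lam'‖ := by
  have growth (lam : F) (y : E) :
      f y + ⟪lam, A y⟫ + μ / 2 * ‖x lam - y‖ ^ 2 ≤ f (x lam) + ⟪lam, A (x lam)⟫ := by
    have hlin : ConvexOn ℝ Set.univ fun z ↦ -⟪lam, A z⟫ :=
      (-(innerSL ℝ lam ∘L A) : E →ₗ[ℝ] ℝ).convexOn convex_univ
    have hg : StrongConvexOn Set.univ μ (-f + fun z ↦ -⟪lam, A z⟫) := by
      simpa [StrongConvexOn] using UniformConvexOn.add hf (uniformConvexOn_zero.2 hlin)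
    have := hg.add_sq_norm_sub_le_of_isMinOn (Set.mem_univ (x lam)) (Set.mem_univ y)
      (isMinOn_iff.2 fun z _ ↦ by
        have := hmax lam z
        simp only [Pi.add_apply, Pi.neg_apply]
        linarith)
    simp only [Pi.add_apply, Pi.neg_apply] at this
    linarith
  intro lam lam'
  set d := ‖x lam - x lam'‖ with hd
  have hA : ‖A (x lam) - A (x lam')‖ ≤ ‖A‖ * d := by
    rw [← map_sub]
    exact A.le_opNorm _
  have hmono : μ * d ^ 2 ≤ ⟪lam - lam', A (x lam) - A (x lam')⟫ := by
    have h₁ := growth lam (x lam')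
    have h₂ := growth lam' (x lam)
    rw [norm_sub_rev] at h₂
    simp only [inner_sub_left, inner_sub_right]
    linarith
  have hsq : d * (μ * d) ≤ d * (‖A‖ * ‖lam - lam'‖) := calc
    d * (μ * d) = μ * d ^ 2 := by ring
    _ ≤ ‖lam - lam'‖ * ‖A (x lam) - A (x lam')‖ := hmono.trans (real_inner_le_norm _ _)
    _ ≤ ‖lam - lam'‖ * (‖A‖ * d) := by gcongr
    _ = d * (‖A‖ * ‖lam - lam'‖) := by ring
  have hdist : μ * d ≤ ‖A‖ * ‖lam - lam'‖ := by
    rcases (norm_nonneg (x lam - x lam')).eq_or_lt with h | h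
    · rw [hd, ← h, mul_zero]
      positivity
    · exact le_of_mul_le_mul_left hsq h
  calc ‖A (x lam) - A (x lam')‖ ≤ ‖A‖ * d := hA
    _ ≤ ‖A‖ * (‖A‖ * ‖lam - lam'‖ / μ) := by
      gcongr
      rwa [le_div_iff₀' hμ]
    _ = ‖A‖ ^ 2 / μ * ‖lam - lam'‖ := by ring
end

section
/- Let E, F be finite-dimensional real inner product spaces, A : E → F a continuous linear map, μ > 0, and f : E → ℝ a continuous function such that −f is μ-strongly convex on E. For λ ∈ F, let x(λ) ∈ E be the (unique) maximizer over E of x ↦ f(x) + ⟪λ, A x⟫, and define h(λ) := f(x(λ)) + ⟪λ, A(x(λ))⟫. Then for every λ₀ ∈ F, h is differentiable at λ₀ with gradient ∇h(λ₀) = A(x(λ₀)). -/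
open scoped RealInnerProductSpace

/-- A maximizer `x` of a `μ`-strongly concave function perturbed by a linear functional satisfies
a quadratic growth inequality. -/
theorem StrongConvexOn.quadratic_growth_of_neg_of_isMax
    {E : Type*} [NormedAddCommGroup E] [NormedSpace ℝ E] {μ : ℝ} {f : E → ℝ}
    (hf : StrongConvexOn Set.univ μ (-f)) (ℓ : E →L[ℝ] ℝ) {x : E}
    (hx : ∀ y, f y + ℓ y ≤ f x + ℓ x) (y : E) :
    f y + ℓ y + μ / 4 * ‖x - y‖ ^ 2 ≤ f x + ℓ x := by
  have hmid := hf.2 (Set.mem_univ x) (Set.mem_univ y)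
    (by norm_num : (0 : ℝ) ≤ 1 / 2) (by norm_num : (0 : ℝ) ≤ 1 / 2) (by norm_num)
  have hle := hx ((1 / 2 : ℝ) • x + (1 / 2 : ℝ) • y)
  simp only [Pi.neg_apply, smul_eq_mul, map_add, map_smul] at hmid hle
  linarith

/-- Danskin-type formula (equation (6)): the dual function
`h(λ) = f(x(λ)) + ⟪λ, A x(λ)⟫` of a continuous μ-strongly concave objective is
differentiable with gradient `∇h(λ₀) = A x(λ₀)`. -/
theorem stmt17
    {E F : Type*} [NormedAddCommGroup E] [InnerProductSpace ℝ E] [FiniteDimensional ℝ E]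
    [NormedAddCommGroup F] [InnerProductSpace ℝ F] [FiniteDimensional ℝ F]
    (A : E →L[ℝ] F) (μ : ℝ) (hμ : 0 < μ)
    (f : E → ℝ) (hfc : Continuous f) (hf : StrongConvexOn Set.univ μ (-f))
    (x : F → E)
    (hmax : ∀ (lam : F) (y : E), f y + ⟪lam, A y⟫ ≤ f (x lam) + ⟪lam, A (x lam)⟫)
    (h : F → ℝ) (hdef : ∀ lam : F, h lam = f (x lam) + ⟪lam, A (x lam)⟫) :
    ∀ lam₀ : F, HasGradientAt h (A (x lam₀)) lam₀ := by
  intro lam₀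
  rw [hasGradientAt_iff_isLittleO]
  have hbig : (fun lam => h lam - h lam₀ - ⟪A (x lam₀), lam - lam₀⟫) =O[nhds lam₀]
      fun lam => ‖lam - lam₀‖ ^ 2 := by
    refine Asymptotics.IsBigO.of_bound (‖A‖ ^ 2 / μ) (Filter.Eventually.of_forall fun lam => ?_)
    have hlow := hmax lam (x lam₀)
    have hgrowth := hf.quadratic_growth_of_neg_of_isMax ((innerSL ℝ lam₀).comp A)
      (hmax lam₀) (x lam)
    simp only [ContinuousLinearMap.comp_apply, innerSL_apply_apply] at hgrowth
    have hcs : ⟪lam - lam₀, A (x lam - x lam₀)⟫ ≤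
        ‖lam - lam₀‖ * (‖A‖ * ‖x lam₀ - x lam‖) := by
      rw [norm_sub_rev (x lam₀)]
      exact (real_inner_le_norm _ _).trans (by gcongr; exact A.le_opNorm _)
    have hyoung : ‖lam - lam₀‖ * (‖A‖ * ‖x lam₀ - x lam‖) - μ / 4 * ‖x lam₀ - x lam‖ ^ 2 ≤
        ‖A‖ ^ 2 / μ * ‖lam - lam₀‖ ^ 2 := by
      rw [div_mul_eq_mul_div (‖A‖ ^ 2), le_div_iff₀ hμ]
      nlinarith [sq_nonneg (‖A‖ * ‖lam - lam₀‖ - μ / 2 * ‖x lam₀ - x lam‖)]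
    simp only [map_sub, inner_sub_left, inner_sub_right] at hcs
    rw [hdef, hdef, ← real_inner_comm (A (x lam₀)) (lam - lam₀), inner_sub_left, Real.norm_of_nonneg (by linarith),
      Real.norm_of_nonneg (by positivity)]
    linarith
  exact hbig.trans_isLittleO (Asymptotics.isLittleO_norm_pow_id one_lt_two |>.comp_tendsto
    (tendsto_sub_nhds_zero_iff.mpr Filter.tendsto_id))
end
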